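/- Let P be a polyhedron satisfying (A1)–(A3), let Q = ℙ₂(P) endowed with the norm ‖q‖_Q = h_P² ‖q‖_{0,P}. Then the bilinear form b(v,q) = ∫_P q v satisfies the inf-sup condition on H²₀(P) × Q: for every q ∈ Q, sup_{v ∈ H²₀(P)} (∫_P q v dP)/|v|_{2,P} ≳ h_P² ‖q‖_{0,P}, with hidden constant independent of P. (A valid test function is v = b_T² q, where b_T is the standard quartic bubble on any of the uniformly shape-regular tetrahedra contained in P provided by the star-shapedness.) -/

import Mathlib

/-!
Common framework for the formalization of
"A C¹ Virtual Element Method on polyhedral meshes"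
(Beirão da Veiga, Dassi, Russo).

We work in `E3 = ℝ³` (as a Euclidean space).  Sobolev (semi)norms are
modelled by `L²`-integrals of iterated Fréchet derivatives, `H²₀` by
approximability by smooth compactly supported functions, polynomial
spaces by restrictions of multivariate polynomials, and the various
virtual element spaces/projectors by data satisfying their defining
properties.
-/

open MeasureTheory Metric Set
open scoped BigOperators ENNReal NNReal RealInnerProductSpace

noncomputable section

abbrev E3 := EuclideanSpace ℝ (Fin 3)

/-- The 2-dimensional Hausdorff (surface) measure on `ℝ³`. -/
def surf : Measure E3 := Measure.hausdorffMeasure 2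

/-- `L²`-type Sobolev seminorm of order `k` on a set `D`:
`|u|_{k,D} = (∫_D ‖D^k u‖²)^{1/2}`. -/
def sNorm (k : ℕ) (D : Set E3) (u : E3 → ℝ) : ℝ :=
  Real.sqrt (∫ x in D, ‖iteratedFDeriv ℝ k u x‖ ^ 2)

/-- Full Sobolev norm of order `m` on `D`. -/
def sobNorm (m : ℕ) (D : Set E3) (u : E3 → ℝ) : ℝ :=
  Real.sqrt (∑ k ∈ Finset.range (m + 1), sNorm k D u ^ 2)

/-- Membership in `H^m(D)` (square integrability of all derivatives up to order `m`). -/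
def MemH (m : ℕ) (D : Set E3) (u : E3 → ℝ) : Prop :=
  ∀ k ≤ m, IntegrableOn (fun x => ‖iteratedFDeriv ℝ k u x‖ ^ 2) D volume

/-- Smooth test function compactly supported in `D`. -/
def TestFun (D : Set E3) (φ : E3 → ℝ) : Prop :=
  ContDiff ℝ (⊤ : ℕ∞) φ ∧ HasCompactSupport φ ∧ tsupport φ ⊆ interior D

/-- Membership in `H²₀(D)`: an `H²` function approximable in the `H²` norm by smooth
functions compactly supported in `D`; this encodes `v = ∂ₙ v = 0` on `∂D`. -/
def MemH20 (D : Set E3) (v : E3 → ℝ) : Prop :=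
  MemH 2 D v ∧ ∀ ε > 0, ∃ φ, TestFun D φ ∧ sobNorm 2 D (fun x => v x - φ x) < ε

/-- `v` coincides on `D` with a polynomial of total degree `≤ k`. -/
def IsPolyOn (k : ℕ) (D : Set E3) (v : E3 → ℝ) : Prop :=
  ∃ p : MvPolynomial (Fin 3) ℝ, p.totalDegree ≤ k ∧
    ∀ x ∈ D, v x = MvPolynomial.eval (fun i => x i) p

/-- Frobenius inner product of the Hessians of `v` and `w` at `x`. -/
def hessInner (v w : E3 → ℝ) (x : E3) : ℝ :=
  ∑ i : Fin 3, ∑ j : Fin 3,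
    (iteratedFDeriv ℝ 2 v x ![EuclideanSpace.single i 1, EuclideanSpace.single j 1]) *
    (iteratedFDeriv ℝ 2 w x ![EuclideanSpace.single i 1, EuclideanSpace.single j 1])

/-- Laplacian of `v` at `x`. -/
def lap (v : E3 → ℝ) (x : E3) : ℝ :=
  ∑ i : Fin 3, iteratedFDeriv ℝ 2 v x ![EuclideanSpace.single i 1, EuclideanSpace.single i 1]

/-- Bilinear form `a^Δ_D(v,w) = ∫_D ∇²v : ∇²w`. -/
def aD (D : Set E3) (v w : E3 → ℝ) : ℝ := ∫ x in D, hessInner v w x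

/-- Bilinear form `a^∇_D(v,w) = ∫_D ∇v · ∇w`. -/
def aG (D : Set E3) (v w : E3 → ℝ) : ℝ := ∫ x in D, ⟪gradient v x, gradient w x⟫

/-- Bilinear form `a⁰_D(v,w) = ∫_D v w`. -/
def a0 (D : Set E3) (v w : E3 → ℝ) : ℝ := ∫ x in D, v x * w x

/-- Weak form of `Δ² v = q` in `D`:
`∫_D ∇²v : ∇²φ = ∫_D q φ` for every smooth `φ` compactly supported in `D`. -/
def WeakBiharmonicEq (D : Set E3) (v q : E3 → ℝ) : Prop :=
  ∀ φ, TestFun D φ → ∫ x in D, hessInner v φ x = ∫ x in D, q x * φ x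

/-- `a` and `b` have the same (distributional) bi-Laplacian in `D`. -/
def SameBiharmonic (D : Set E3) (a b : E3 → ℝ) : Prop :=
  ∀ φ, TestFun D φ → ∫ x in D, hessInner a φ x = ∫ x in D, hessInner b φ x

/-- `H^{-1}(D)`-type dual norm of `Δ²u` (pairing realized through the Hessian form). -/
def biharmDualNorm (D : Set E3) (u : E3 → ℝ) : ℝ :=
  sSup { t | ∃ φ, TestFun D φ ∧ sNorm 1 D φ ≤ 1 ∧ t = ∫ x in D, hessInner u φ x }

/-- `D` is star-shaped with respect to a ball of radius `≥ ρ · diam D`. -/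
def StarShapedBall (ρ : ℝ) (D : Set E3) : Prop :=
  ∃ z r, ρ * diam D ≤ r ∧ 0 < r ∧ ball z r ⊆ D ∧
    ∀ x ∈ D, ∀ y ∈ ball z r, segment ℝ x y ⊆ D

/-- A planar face `f` is star-shaped with respect to a disc (ball intersected with the
plane of the face) of radius `≥ ρ · diam f`. -/
def StarShapedFace (ρ : ℝ) (f : Set E3) : Prop :=
  ∃ z r, ρ * diam f ≤ r ∧ 0 < r ∧
    ball z r ∩ (affineSpan ℝ f : Set E3) ⊆ f ∧
    ∀ x ∈ f, ∀ y ∈ ball z r ∩ (affineSpan ℝ f : Set E3), segment ℝ x y ⊆ f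

/-- A (bounded, open, nonempty) polyhedron: its boundary is contained in finitely many
proper affine subspaces (the face planes). -/
def IsPolyhedron (P : Set E3) : Prop :=
  IsOpen P ∧ Bornology.IsBounded P ∧ P.Nonempty ∧
  ∃ H : Finset (AffineSubspace ℝ E3), (∀ A ∈ H, A ≠ ⊤) ∧
    frontier P ⊆ ⋃ A ∈ (H : Set (AffineSubspace ℝ E3)), (A : Set E3)

/-- `P` has a Lipschitz boundary with Lipschitz constant `L`: near every boundary point,
in a suitable orthonormal frame, `P` is the strict epigraph of an `L`-Lipschitz function. -/
def LipschitzBoundary (L : ℝ≥0) (P : Set E3) : Prop :=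
  ∀ p ∈ frontier P, ∃ r > 0, ∃ b : OrthonormalBasis (Fin 3) ℝ E3, ∃ φ : ℝ × ℝ → ℝ,
    LipschitzWith L φ ∧
    ∀ x ∈ ball p r, (x ∈ P ↔ φ (⟪x, b 0⟫, ⟪x, b 1⟫) < ⟪x, b 2⟫)

/-- `n` is the outward unit normal of the planar set `f ⊆ ∂P`. -/
def IsOuterNormal (P f : Set E3) (n : E3) : Prop :=
  ‖n‖ = 1 ∧ (∀ x ∈ f, ∀ y ∈ f, ⟪x - y, n⟫ = 0) ∧
  ∀ x ∈ f, ∀ᶠ t : ℝ in nhdsWithin 0 (Ioi 0), x + t • n ∉ closure P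

/-- The data of the local `C¹` virtual element construction on the polyhedron `P` with
faces `F` and vertices `V`: the two-dimensional face spaces `V_h^Δ(f)` (= `VhD f`) and
`V_h^∇(f)` (= `VhN f`), the outward face normals, and the projectors
`Π^Δ_P, Π^∇_P, Π⁰_P` (and the face projectors `Π^Δ_f`, `Π^∇_f`), together with their
defining properties from the paper. -/
structure C1LocalData (P : Set E3) (F : Finset (Set E3)) (V : Finset E3) where
  /-- face `C¹` virtual spaces `V_h^Δ(f)` -/
  VhD : Set E3 → Set (E3 → ℝ)
  /-- face nodal virtual spaces `V_h^∇(f)` -/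
  VhN : Set E3 → Set (E3 → ℝ)
  /-- outward unit normal of each face -/
  nrm : Set E3 → E3
  /-- `Π^Δ_P` -/
  projD : (E3 → ℝ) → (E3 → ℝ)
  /-- `Π^∇_P` -/
  projG : (E3 → ℝ) → (E3 → ℝ)
  /-- `Π⁰_P` -/
  proj0 : (E3 → ℝ) → (E3 → ℝ)
  /-- face projectors `Π^Δ_f` -/
  projDf : Set E3 → (E3 → ℝ) → (E3 → ℝ)
  /-- face projectors `Π^∇_f` -/
  projNf : Set E3 → (E3 → ℝ) → (E3 → ℝ)
  nrm_outer : ∀ f ∈ F, IsOuterNormal P f (nrm f)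
  projD_poly : ∀ v, IsPolyOn 2 univ (projD v)
  projD_fix : ∀ q, IsPolyOn 2 univ q → projD q = q
  projD_ortho : ∀ v, MemH 2 P v → ∀ q, IsPolyOn 2 univ q → aD P (projD v) q = aD P v q
  projD_bdry : ∀ v, MemH 2 P v → ∀ q, IsPolyOn 1 univ q →
    ∫ x in frontier P, projD v x * q x ∂surf = ∫ x in frontier P, v x * q x ∂surf
  proj0_poly : ∀ v, IsPolyOn 2 univ (proj0 v)
  proj0_fix : ∀ q, IsPolyOn 2 univ q → proj0 q = q
  proj0_ortho : ∀ v, IntegrableOn v P volume → ∀ q, IsPolyOn 2 univ q →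
    ∫ x in P, proj0 v x * q x = ∫ x in P, v x * q x
  projG_poly : ∀ v, IsPolyOn 2 univ (projG v)
  projG_fix : ∀ q, IsPolyOn 2 univ q → projG q = q
  projG_ortho : ∀ v, MemH 1 P v → ∀ q, IsPolyOn 2 univ q → aG P (projG v) q = aG P v q
  projG_mean : ∀ v, IntegrableOn v P volume → ∫ x in P, projG v x = ∫ x in P, v x
  projDf_poly : ∀ f v, IsPolyOn 2 univ (projDf f v)
  projDf_enh : ∀ f ∈ F, ∀ v ∈ VhD f, ∀ q, IsPolyOn 1 univ q →
    ∫ x in f, projDf f v x * q x ∂surf = ∫ x in f, v x * q x ∂surf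
  projNf_enh : ∀ f ∈ F, ∀ v ∈ VhN f, ∫ x in f, projNf f v x ∂surf = ∫ x in f, v x ∂surf
  VhD_poly : ∀ f ∈ F, ∀ q, IsPolyOn 2 univ q → q ∈ VhD f
  VhN_poly : ∀ f ∈ F, ∀ q, IsPolyOn 1 univ q → q ∈ VhN f
  VhD_dofs : ∀ f ∈ F, ∀ v ∈ VhD f, ∀ w ∈ VhD f,
    (∀ ν ∈ V, ν ∈ closure f → v ν = w ν ∧ gradient v ν = gradient w ν) → EqOn v w f
  VhN_dofs : ∀ f ∈ F, ∀ v ∈ VhN f, ∀ w ∈ VhN f,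
    (∀ ν ∈ V, ν ∈ closure f → v ν = w ν) → EqOn v w f

/-- Skeleton (union of the edges) of an element. -/
def skeleton (Ed : Finset (Set E3)) : Set E3 := ⋃ e ∈ (Ed : Set (Set E3)), e

/-- The auxiliary local space `Ṽ_h(P)`:
`H²` functions with `Δ²v ∈ ℙ₂`, `v` and `∇v` continuous on the skeleton, whose face
restrictions lie in `V_h^Δ(f)` and whose face normal derivatives lie in `V_h^∇(f)`. -/
def VhTilde (P : Set E3) (F Ed : Finset (Set E3)) (V : Finset E3)
    (D : C1LocalData P F V) : Set (E3 → ℝ) :=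
  {v | MemH 2 P v ∧ (∃ q, IsPolyOn 2 univ q ∧ WeakBiharmonicEq P v q) ∧
    ContinuousOn v (skeleton Ed) ∧ ContinuousOn (fun x => gradient v x) (skeleton Ed) ∧
    ∀ f ∈ F, v ∈ D.VhD f ∧ (fun x => ⟪gradient v x, D.nrm f⟫) ∈ D.VhN f}

/-- The local `C¹` virtual element space `V_h(P)` (enhanced with the `Π^Δ_P` moment
condition). -/
def VhSpace (P : Set E3) (F Ed : Finset (Set E3)) (V : Finset E3)
    (D : C1LocalData P F V) : Set (E3 → ℝ) :=
  {v ∈ VhTilde P F Ed V D |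
    ∀ q, IsPolyOn 2 univ q → ∫ x in P, D.projD v x * q x = ∫ x in P, v x * q x}

/-- The auxiliary local space `W_h(P)` of biharmonic virtual functions. -/
def WhSpace (P : Set E3) (F Ed : Finset (Set E3)) (V : Finset E3)
    (D : C1LocalData P F V) : Set (E3 → ℝ) :=
  {v | MemH 2 P v ∧ WeakBiharmonicEq P v 0 ∧
    ContinuousOn v (skeleton Ed) ∧ ContinuousOn (fun x => gradient v x) (skeleton Ed) ∧
    ∀ f ∈ F, v ∈ D.VhD f ∧ (fun x => ⟪gradient v x, D.nrm f⟫) ∈ D.VhN f}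

/-- Vertex stabilization `s_P(v,w) = Σ_ν (v(ν)w(ν) + h_ν² ∇v(ν)·∇w(ν))`. -/
def stab (V : Finset E3) (hv : E3 → ℝ) (v w : E3 → ℝ) : ℝ :=
  ∑ ν ∈ V, (v ν * w ν + hv ν ^ 2 * ⟪gradient v ν, gradient w ν⟫)

/-- Discrete local form `a_{h,P}^Δ`. -/
def ahD {P : Set E3} {F : Finset (Set E3)} {V : Finset E3} (D : C1LocalData P F V)
    (hv : E3 → ℝ) (v w : E3 → ℝ) : ℝ :=
  aD P (D.projD v) (D.projD w) +
    (diam P)⁻¹ * stab V hv (fun x => v x - D.projD v x) (fun x => w x - D.projD w x)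

/-- Discrete local form `a_{h,P}^∇`. -/
def ahG {P : Set E3} {F : Finset (Set E3)} {V : Finset E3} (D : C1LocalData P F V)
    (hv : E3 → ℝ) (v w : E3 → ℝ) : ℝ :=
  aG P (D.projG v) (D.projG w) +
    diam P * stab V hv (fun x => v x - D.projG v x) (fun x => w x - D.projG w x)

/-- Discrete local form `a_{h,P}⁰`. -/
def ah0 {P : Set E3} {F : Finset (Set E3)} {V : Finset E3} (D : C1LocalData P F V)
    (hv : E3 → ℝ) (v w : E3 → ℝ) : ℝ :=
  a0 P (D.proj0 v) (D.proj0 w) +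
    diam P ^ 3 * stab V hv (fun x => v x - D.proj0 v x) (fun x => w x - D.proj0 w x)

/-- A polyhedral mesh of `Ω`: open disjoint polyhedral elements whose closures cover `Ω`,
with faces, edges, vertices, the local vertex size parameter `h_ν` and the mesh size. -/
structure Mesh (Ω : Set E3) where
  elems : Finset (Set E3)
  faces : Set E3 → Finset (Set E3)
  edges : Set E3 → Finset (Set E3)
  verts : Set E3 → Finset E3
  /-- local mesh-size parameter `h_ν` attached to the vertices -/
  hv : E3 → ℝ
  /-- mesh size `h` -/
  size : ℝ
  size_pos : 0 < size
  elem_poly : ∀ P ∈ elems, IsPolyhedron P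
  covers : Ω = ⋃ P ∈ (elems : Set (Set E3)), closure P
  disj : (elems : Set (Set E3)).Pairwise Disjoint
  faces_cover : ∀ P ∈ elems, frontier P = ⋃ f ∈ ((faces P : Finset (Set E3)) : Set (Set E3)), f
  diam_le : ∀ P ∈ elems, diam P ≤ size

/-- Shape-regularity of a single element, with regularity parameter `ρ`:
(A1) star-shapedness of `P` w.r.t. a comparable ball, (A2) star-shapedness of the faces
w.r.t. comparable discs, (A3) comparability of edge lengths and face diameters with
`h_P` (together with comparability of the vertex parameter `h_ν`). -/
def ElemRegular (ρ : ℝ) (P : Set E3) (F Ed : Finset (Set E3)) (V : Finset E3)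
    (hv : E3 → ℝ) : Prop :=
  StarShapedBall ρ P ∧
  (∀ f ∈ F, StarShapedFace ρ f) ∧
  (∀ f ∈ F, ρ * diam P ≤ diam f ∧ diam f ≤ diam P) ∧
  (∀ e ∈ Ed, ρ * diam P ≤ diam e ∧ diam e ≤ diam P) ∧
  (∀ ν ∈ V, ρ * diam P ≤ hv ν ∧ hv ν ≤ diam P / ρ)

/-- Mesh assumptions (A1)–(A3) with uniform regularity parameter `ρ`. -/
def MeshRegular (ρ : ℝ) {Ω : Set E3} (T : Mesh Ω) : Prop :=
  ∀ P ∈ T.elems, ElemRegular ρ P (T.faces P) (T.edges P) (T.verts P) T.hv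

/-- The global `C¹` virtual element space `V_h(Ω_h)` together with the local VEM data. -/
structure C1GlobalVEM (Ω : Set E3) (T : Mesh Ω) where
  loc : (P : Set E3) → C1LocalData P (T.faces P) (T.verts P)
  Vh : Set (E3 → ℝ)
  Vh_def : ∀ v, v ∈ Vh ↔
    MemH 2 Ω v ∧ ∀ P ∈ T.elems, v ∈ VhSpace P (T.faces P) (T.edges P) (T.verts P) (loc P)

/-- The global auxiliary space `W_h(Ω_h)` together with the local VEM data. -/
structure WhGlobalVEM (Ω : Set E3) (T : Mesh Ω) where
  loc : (P : Set E3) → C1LocalData P (T.faces P) (T.verts P)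
  Wh : Set (E3 → ℝ)
  Wh_def : ∀ v, v ∈ Wh ↔
    MemH 2 Ω v ∧ ∀ P ∈ T.elems, v ∈ WhSpace P (T.faces P) (T.edges P) (T.verts P) (loc P)

/-- Broken Sobolev seminorm over the mesh. -/
def brokenSNorm (k : ℕ) {Ω : Set E3} (T : Mesh Ω) (u : E3 → ℝ) : ℝ :=
  Real.sqrt (∑ P ∈ T.elems, sNorm k P u ^ 2)

/-- Broken full Sobolev norm over the mesh. -/
def brokenSobNorm (m : ℕ) {Ω : Set E3} (T : Mesh Ω) (u : E3 → ℝ) : ℝ :=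
  Real.sqrt (∑ P ∈ T.elems, sobNorm m P u ^ 2)

/-- Global discrete energy `Σ_P (c₁ a_{h,P}^Δ + c₂ a_{h,P}^∇ + c₃ a_{h,P}⁰)`. -/
def discEnergy (c₁ c₂ c₃ : ℝ) {Ω : Set E3} (T : Mesh Ω) (G : C1GlobalVEM Ω T)
    (v w : E3 → ℝ) : ℝ :=
  ∑ P ∈ T.elems,
    (c₁ * ahD (G.loc P) T.hv v w + c₂ * ahG (G.loc P) T.hv v w + c₃ * ah0 (G.loc P) T.hv v w)

/-- Global discrete right-hand side `(f_h, v_h) = Σ_P ∫_P Π⁰_P v_h · f`. -/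
def discRhs {Ω : Set E3} (T : Mesh Ω) (G : C1GlobalVEM Ω T) (f v : E3 → ℝ) : ℝ :=
  ∑ P ∈ T.elems, ∫ x in P, (G.loc P).proj0 v x * f x

/-- `u` is a weak solution of `c₁Δ²u − c₂Δu + c₃u = f` in `Ω` (Dirichlet data being
carried by `u` itself): the variational identity holds against all of `H²₀(Ω)`. -/
def ContinuousSolution (Ω : Set E3) (c₁ c₂ c₃ : ℝ) (f u : E3 → ℝ) : Prop :=
  MemH 2 Ω u ∧ ∀ v, MemH20 Ω v →
    c₁ * aD Ω u v + c₂ * aG Ω u v + c₃ * a0 Ω u v = ∫ x in Ω, f x * v x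

/-- `u_h` is a solution of the discrete virtual element problem. -/
def DiscreteSolution {Ω : Set E3} (T : Mesh Ω) (G : C1GlobalVEM Ω T)
    (c₁ c₂ c₃ : ℝ) (f u_h : E3 → ℝ) : Prop :=
  u_h ∈ G.Vh ∧ ∀ v ∈ G.Vh, MemH20 Ω v →
    discEnergy c₁ c₂ c₃ T G u_h v = discRhs T G f v

/-- The function on `ℝ³` induced by a multivariate polynomial. -/
def polyFn (p : MvPolynomial (Fin 3) ℝ) (y : E3) : ℝ := MvPolynomial.eval (fun i => y i) p

lemma contDiff_polyFn (p : MvPolynomial (Fin 3) ℝ) {n : WithTop ℕ∞} :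
    ContDiff ℝ n (polyFn p) := by
  induction p using MvPolynomial.induction_on with
  | C a =>
    have : polyFn (MvPolynomial.C a) = fun _ => a := by ext y; simp [polyFn]
    rw [this]; exact contDiff_const
  | add p q hp hq =>
    have : polyFn (p + q) = fun y => polyFn p y + polyFn q y := by ext y; simp [polyFn]
    rw [this]; exact hp.add hq
  | mul_X p i hp =>
    have : polyFn (p * MvPolynomial.X i) = fun y => polyFn p y * y i := by ext y; simp [polyFn]
    rw [this]
    exact hp.mul (by fun_prop)

/-- A polynomial vanishing near the origin is the zero polynomial. -/
lemma eq_zero_of_polyFn_eq_zero_on_ball {p : MvPolynomial (Fin 3) ℝ} {r : ℝ} (hr : 0 < r)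
    (h : ∀ y ∈ ball (0 : E3) r, polyFn p y = 0) : p = 0 := by
  refine MvPolynomial.funext_set (fun _ => Ioo (-(r / 2)) (r / 2))
    (fun _ => Ioo_infinite (by linarith)) fun x hx => ?_
  have hx' : ∀ i, x i ^ 2 < (r / 2) ^ 2 := fun i => by
    have := hx i (mem_univ i)
    exact sq_lt_sq' this.1 this.2
  have := h (WithLp.toLp 2 x) (by
    rw [mem_ball_zero_iff, EuclideanSpace.norm_eq, Real.sqrt_lt' hr]
    simp only [Fin.sum_univ_three, Real.norm_eq_abs, sq_abs]
    nlinarith [hx' 0, hx' 1, hx' 2])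
  simpa [polyFn] using this

/-- Affine changes of variables do not raise the degree of a polynomial. -/
lemma exists_polyFn_comp_affine (p : MvPolynomial (Fin 3) ℝ) (z : E3) (h : ℝ) :
    ∃ p' : MvPolynomial (Fin 3) ℝ, p'.totalDegree ≤ p.totalDegree ∧
      ∀ y, polyFn p' y = polyFn p (z + h • y) := by
  refine ⟨MvPolynomial.bind₁
    (fun i => MvPolynomial.C (z i) + MvPolynomial.C h * MvPolynomial.X i) p, ?_, fun y => ?_⟩
  · rw [MvPolynomial.bind₁, MvPolynomial.aeval_def, MvPolynomial.eval₂_eq]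
    refine (MvPolynomial.totalDegree_finsetSum _ _).trans (Finset.sup_le fun d hd => ?_)
    refine (MvPolynomial.totalDegree_mul _ _).trans ?_
    rw [MvPolynomial.algebraMap_eq, MvPolynomial.totalDegree_C, zero_add]
    refine (MvPolynomial.totalDegree_finsetProd _ _).trans ?_
    refine le_trans (Finset.sum_le_sum (g := fun i => d i) fun i _ => ?_)
      (MvPolynomial.le_totalDegree hd)
    refine (MvPolynomial.totalDegree_pow _ _).trans ?_
    have : (MvPolynomial.C (z i) + MvPolynomial.C h * MvPolynomial.X i :
        MvPolynomial (Fin 3) ℝ).totalDegree ≤ 1 := by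
      refine (MvPolynomial.totalDegree_add _ _).trans (max_le (by simp) ?_)
      refine (MvPolynomial.totalDegree_mul _ _).trans ?_
      simp
    nlinarith
  · simp only [polyFn]
    rw [← MvPolynomial.coe_aeval_eq_eval, ← MvPolynomial.coe_aeval_eq_eval]
    simp only [RingHom.coe_coe, MvPolynomial.aeval_bind₁]
    simp

/-- A continuous, positive, quadratically homogeneous function on a finite-dimensional space
dominates a multiple of the squared norm. -/
lemma exists_mul_norm_sq_le {E : Type*} [NormedAddCommGroup E] [NormedSpace ℝ E]
    [FiniteDimensional ℝ E] {f : E → ℝ} (hf : Continuous f) (hpos : ∀ c, c ≠ 0 → 0 < f c)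
    (hhom : ∀ (t : ℝ) c, f (t • c) = t ^ 2 * f c) :
    ∃ m > 0, ∀ c, m * ‖c‖ ^ 2 ≤ f c := by
  have : ProperSpace E := FiniteDimensional.proper_real E
  have f0 : f 0 = 0 := by simpa using hhom 0 0
  rcases (sphere (0 : E) 1).eq_empty_or_nonempty with he | hne
  · refine ⟨1, one_pos, fun c => ?_⟩
    have hc : c = 0 := by
      by_contra hc
      have : ‖c‖⁻¹ • c ∈ sphere (0 : E) 1 := by simp [norm_smul, hc]
      simp [he] at this
    simp [hc, f0]
  · obtain ⟨c₀, hc₀, hmin⟩ := (isCompact_sphere (0 : E) 1).exists_isMinOn hne hf.continuousOn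
    have hc₀' : c₀ ≠ 0 := by rintro rfl; simp at hc₀
    refine ⟨f c₀, hpos c₀ hc₀', fun c => ?_⟩
    rcases eq_or_ne c 0 with rfl | hc
    · simp [f0]
    have hn : ‖c‖ ≠ 0 := norm_ne_zero_iff.2 hc
    have h1 : f c₀ ≤ f (‖c‖⁻¹ • c) := hmin (by simp [norm_smul, hn])
    calc f c₀ * ‖c‖ ^ 2 ≤ f (‖c‖⁻¹ • c) * ‖c‖ ^ 2 := by gcongr
      _ = f c := by rw [hhom]; field_simp

/-- The compactly supported smooth function obtained by multiplying a polynomial by a bump. -/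
def bumpPoly (η : ContDiffBump (0 : E3)) (p : MvPolynomial (Fin 3) ℝ) (y : E3) : ℝ :=
  η y * polyFn p y

lemma contDiff_bumpPoly (η : ContDiffBump (0 : E3)) (p : MvPolynomial (Fin 3) ℝ) {n : ℕ∞} :
    ContDiff ℝ n (bumpPoly η p) :=
  η.contDiff.mul (contDiff_polyFn p)

lemma hasCompactSupport_bumpPoly (η : ContDiffBump (0 : E3)) (p : MvPolynomial (Fin 3) ℝ) :
    HasCompactSupport (bumpPoly η p) :=
  η.hasCompactSupport.mul_right

lemma integral_bumpPoly_mul_self_pos (η : ContDiffBump (0 : E3)) {p : MvPolynomial (Fin 3) ℝ}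
    (hp : p ≠ 0) : 0 < ∫ y, bumpPoly η p y * polyFn p y := by
  obtain ⟨y, hy, hpy⟩ : ∃ y ∈ ball (0 : E3) η.rIn, polyFn p y ≠ 0 := by
    by_contra! h
    exact hp (eq_zero_of_polyFn_eq_zero_on_ball η.rIn_pos h)
  have hc := (contDiff_polyFn p (n := 0)).continuous
  refine Continuous.integral_pos_of_hasCompactSupport_nonneg_nonzero
    ((η.continuous.mul hc).mul hc) (hasCompactSupport_bumpPoly η p).mul_right
    (fun x => ?_) (x := y) ?_
  · have := mul_nonneg (η.nonneg (x := x)) (mul_self_nonneg (polyFn p x))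
    simpa [bumpPoly, mul_assoc] using this
  · simp [bumpPoly, η.one_of_mem_closedBall (ball_subset_closedBall hy), hpy]

/-- Equivalence of norms on quadratic polynomials on the reference configuration. -/
lemma exists_quadratic_estimates (η : ContDiffBump (0 : E3)) :
    ∃ m > 0, ∃ K > 0, ∀ p : MvPolynomial (Fin 3) ℝ, p.totalDegree ≤ 2 → ∃ N ≥ 0,
      (∀ y ∈ closedBall (0 : E3) 1, |polyFn p y| ≤ K * N) ∧
      (∀ y, ‖iteratedFDeriv ℝ 2 (bumpPoly η p) y‖ ≤ K * N) ∧
      m * N ^ 2 ≤ ∫ y, bumpPoly η p y * polyFn p y := by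
  obtain ⟨n, ⟨b⟩⟩ : ∃ n, Nonempty
      (Module.Basis (Fin n) ℝ (MvPolynomial.restrictTotalDegree (Fin 3) ℝ 2)) :=
    ⟨_, ⟨Module.finBasis ℝ _⟩⟩
  set P : (Fin n → ℝ) → MvPolynomial (Fin 3) ℝ :=
    fun c => ∑ i, c i • (b i : MvPolynomial (Fin 3) ℝ) with hP
  have hPfn : ∀ c, polyFn (P c) = fun y => ∑ i, c i * polyFn (b i) y := fun c => by
    ext y; simp [hP, polyFn, MvPolynomial.smul_eval]
  have hPb : ∀ c, bumpPoly η (P c) = ∑ i, fun y => c i • bumpPoly η (b i) y := fun c => by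
    ext y
    simp only [bumpPoly, hPfn, Finset.sum_apply, smul_eq_mul, Finset.mul_sum]
    exact Finset.sum_congr rfl fun i _ => by ring
  have hPinj : ∀ c, P c = 0 → c = 0 := fun c hc => by
    have h1 : ∑ i, c i • b i = 0 := Subtype.ext (by simpa [hP] using hc)
    exact funext fun i => Fintype.linearIndependent_iff.1 b.linearIndependent c h1 i
  have hA : ∀ c, ∫ y, bumpPoly η (P c) y * polyFn (P c) y =
      ∑ i, ∑ j, c i * c j * ∫ y, bumpPoly η (b i) y * polyFn (b j) y := fun c => by
    have hInt : ∀ i j, Integrable fun y => c i * c j * (bumpPoly η (b i) y * polyFn (b j) y) :=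
      fun i j => (((contDiff_bumpPoly η (b i) (n := 0)).continuous.mul
        (contDiff_polyFn (b j) (n := 0)).continuous).integrable_of_hasCompactSupport
          (hasCompactSupport_bumpPoly η _).mul_right).const_mul _
    simp_rw [← integral_const_mul]
    rw [← integral_congr_ae (Filter.Eventually.of_forall fun y => ?_), integral_finsetSum]
    · exact Finset.sum_congr rfl fun i _ => integral_finsetSum _ fun j _ => hInt i j
    · exact fun i _ => integrable_finsetSum _ fun j _ => hInt i j
    · simp only [hPb, hPfn, Finset.sum_apply, Finset.sum_mul_sum, smul_eq_mul]
      exact Finset.sum_congr rfl fun i _ => Finset.sum_congr rfl fun j _ => by ring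
  obtain ⟨m, hm, hmA⟩ := exists_mul_norm_sq_le
    (f := fun c : Fin n → ℝ => ∫ y, bumpPoly η (P c) y * polyFn (P c) y)
    (by simp_rw [hA]; fun_prop)
    (fun c hc => integral_bumpPoly_mul_self_pos η fun h => hc (hPinj c h))
    (fun t c => by
      simp_rw [hA, Finset.mul_sum, Pi.smul_apply, smul_eq_mul]
      exact Finset.sum_congr rfl fun i _ => Finset.sum_congr rfl fun j _ => by ring)
  have hK1 : ∀ i, ∃ C, ∀ y ∈ closedBall (0 : E3) 1, ‖polyFn (b i) y‖ ≤ C := fun i =>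
    (isCompact_closedBall 0 1).exists_bound_of_continuousOn
      (contDiff_polyFn (b i) (n := 0)).continuous.continuousOn
  have hK2 : ∀ i, ∃ C, ∀ y, ‖iteratedFDeriv ℝ 2 (bumpPoly η (b i)) y‖ ≤ C := fun i =>
    ((contDiff_bumpPoly η (b i) (n := 2)).continuous_iteratedFDeriv
      (m := 2) le_rfl).bounded_above_of_compact_support
        ((hasCompactSupport_bumpPoly η _).iteratedFDeriv 2)
  choose K1 hK1 using hK1
  choose K2 hK2 using hK2
  have h1 : 0 ≤ ∑ i, |K1 i| := Finset.sum_nonneg fun i _ => abs_nonneg _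
  have h2 : 0 ≤ ∑ i, |K2 i| := Finset.sum_nonneg fun i _ => abs_nonneg _
  refine ⟨m, hm, 1 + ∑ i, |K1 i| + ∑ i, |K2 i|, by positivity, fun p hp => ?_⟩
  set c : Fin n → ℝ := b.equivFun ⟨p, (MvPolynomial.mem_restrictTotalDegree _ _ _).2 hp⟩
  have hpc : p = P c := by
    have := congrArg Subtype.val
      (b.sum_equivFun ⟨p, (MvPolynomial.mem_restrictTotalDegree _ _ _).2 hp⟩)
    exact this.symm.trans (by simp only [hP, c, Submodule.coe_sum, Submodule.coe_smul])
  rw [hpc]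
  refine ⟨‖c‖, norm_nonneg _, fun y hy => ?_, fun y => ?_, hmA c⟩
  · calc |polyFn (P c) y| ≤ ∑ i, |c i * polyFn (b i) y| := by
          rw [hPfn]; exact Finset.abs_sum_le_sum_abs _ _
      _ ≤ ∑ i, |K1 i| * ‖c‖ := Finset.sum_le_sum fun i _ => by
          rw [abs_mul, mul_comm]
          exact mul_le_mul ((hK1 i y hy).trans (le_abs_self _)) (norm_le_pi_norm c i)
            (abs_nonneg _) (abs_nonneg _)
      _ ≤ _ := by
          rw [← Finset.sum_mul]
          gcongr
          linarith
  · calc ‖iteratedFDeriv ℝ 2 (bumpPoly η (P c)) y‖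
        ≤ ∑ i, ‖iteratedFDeriv ℝ 2 (fun y => c i • bumpPoly η (b i) y) y‖ := by
          rw [hPb, iteratedFDeriv_sum_apply fun i _ =>
            ((contDiff_bumpPoly η (b i) (n := 2)).const_smul (c i)).contDiffAt]
          exact norm_sum_le _ _
      _ ≤ ∑ i, |K2 i| * ‖c‖ := Finset.sum_le_sum fun i _ => by
          rw [iteratedFDeriv_const_smul_apply' (contDiff_bumpPoly η (b i) (n := 2)).contDiffAt,
            norm_smul, mul_comm]
          exact mul_le_mul ((hK2 i y).trans (le_abs_self _)) (norm_le_pi_norm c i)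
            (norm_nonneg _) (abs_nonneg _)
      _ ≤ _ := by
          rw [← Finset.sum_mul]
          gcongr
          linarith

lemma TestFun.memH20 {D : Set E3} {φ : E3 → ℝ} (hφ : TestFun D φ) : MemH20 D φ := by
  refine ⟨fun k _ => ?_, fun ε hε => ⟨φ, hφ, ?_⟩⟩
  · have hc : Continuous fun x => ‖iteratedFDeriv ℝ k φ x‖ ^ 2 :=
      ((hφ.1.continuous_iteratedFDeriv (m := k) (by exact_mod_cast le_top)).norm.pow 2)
    refine (hc.integrable_of_hasCompactSupport ?_).integrableOn
    exact (hφ.2.1.iteratedFDeriv k).comp_left (g := fun a => ‖a‖ ^ 2) (by simp)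
  · have h0 : (fun x => φ x - φ x) = fun _ => (0 : ℝ) := by ext; simp
    simpa [sobNorm, sNorm, h0] using hε

/-- The `H²` seminorm of a nonzero test function is positive. -/
lemma TestFun.sNorm_two_pos {D : Set E3} {φ : E3 → ℝ} (hφ : TestFun D φ) {x₀ : E3}
    (hx₀ : φ x₀ ≠ 0) : 0 < sNorm 2 D φ := by
  have hsupp : ∀ x, x ∉ D → ‖iteratedFDeriv ℝ 2 φ x‖ ^ 2 = 0 := fun x hx => by
    have : x ∉ tsupport φ := fun h => hx (interior_subset (hφ.2.2 h))
    have := notMem_subset (support_iteratedFDeriv_subset (𝕜 := ℝ) 2) this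
    simpa using this
  rw [sNorm, setIntegral_eq_integral_of_forall_compl_eq_zero hsupp]
  obtain ⟨x, hx⟩ : ∃ x, iteratedFDeriv ℝ 2 φ x ≠ 0 := by
    by_contra! h
    obtain ⟨y, hy⟩ : ∃ y, y ∉ tsupport φ := by
      by_contra! hall
      exact noncompact_univ E3 (by rw [← eq_univ_of_forall hall]; exact hφ.2.1)
    have h2 : ∀ x, fderiv ℝ (fderiv ℝ φ) x = 0 := fun x => by
      ext v w
      have := iteratedFDeriv_two_apply (𝕜 := ℝ) φ x ![v, w]
      rw [h x] at this
      simpa using this.symm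
    have hd : Differentiable ℝ (fderiv ℝ φ) :=
      (hφ.1.fderiv_right (m := 1) (WithTop.coe_le_coe.2 (le_top (a := (2 : ℕ∞))))).differentiable one_ne_zero
    have h1 : ∀ x, fderiv ℝ φ x = 0 := fun x => by
      rw [is_const_of_fderiv_eq_zero hd h2 x y]
      by_contra hne
      exact hy (support_fderiv_subset ℝ hne)
    exact hx₀ ((is_const_of_fderiv_eq_zero (hφ.1.differentiable (by simp)) h1 x₀ y).trans
      (image_eq_zero_of_notMem_tsupport hy))
  refine Real.sqrt_pos.2 (Continuous.integral_pos_of_hasCompactSupport_nonneg_nonzero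
    ((hφ.1.continuous_iteratedFDeriv (m := 2)
      (WithTop.coe_le_coe.2 (le_top (a := (2 : ℕ∞))))).norm.pow 2) ?_
    (fun x => by positivity) (x := x) (by simpa using hx))
  exact (hφ.2.1.iteratedFDeriv 2).comp_left (g := fun a => ‖a‖ ^ 2) (by simp)

lemma norm_iteratedFDeriv_two_comp_affine_le {w : E3 → ℝ} (hw : ContDiff ℝ 2 w) (z : E3) {h : ℝ}
    (hh : 0 < h) (x : E3) :
    ‖iteratedFDeriv ℝ 2 (fun x => w (h⁻¹ • (x - z))) x‖ ≤
      ‖iteratedFDeriv ℝ 2 w (h⁻¹ • (x - z))‖ * (h⁻¹) ^ 2 := by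
  set g : E3 →L[ℝ] E3 := h⁻¹ • ContinuousLinearMap.id ℝ E3
  have hg : ‖g‖ ≤ h⁻¹ := by
    refine (norm_smul_le h⁻¹ (ContinuousLinearMap.id ℝ E3)).trans ?_
    rw [Real.norm_of_nonneg (inv_nonneg.2 hh.le)]
    exact mul_le_of_le_one_right (inv_nonneg.2 hh.le) ContinuousLinearMap.norm_id_le
  have h1 : iteratedFDeriv ℝ 2 (fun x => w (h⁻¹ • (x - z))) x =
      iteratedFDeriv ℝ 2 (w ∘ g) (x - z) :=
    congrFun (iteratedFDeriv_comp_sub' (𝕜 := ℝ) (f := w ∘ g) 2 z) x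
  rw [h1, g.iteratedFDeriv_comp_right hw (x - z) (i := 2) le_rfl]
  refine (ContinuousMultilinearMap.norm_compContinuousLinearMap_le _ _).trans ?_
  rw [Fin.prod_univ_two, ← sq]
  have : g (x - z) = h⁻¹ • (x - z) := rfl
  rw [this]
  gcongr

/-- A pointwise bound of the `k`-th derivative controls the `k`-th seminorm. -/
lemma sNorm_le_of_bound {k : ℕ} {D : Set E3} {u : E3 → ℝ} {B W : ℝ} (hB : 0 ≤ B)
    (hD : volume D < ⊤) (hW : volume.real D ≤ W)
    (hu : ∀ x ∈ D, ‖iteratedFDeriv ℝ k u x‖ ≤ B) : sNorm k D u ≤ B * Real.sqrt W := by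
  have h1 : ∫ x in D, ‖iteratedFDeriv ℝ k u x‖ ^ 2 ≤ B ^ 2 * W := by
    refine (le_abs_self _).trans ?_
    refine (norm_setIntegral_le_of_norm_le_const (f := fun x => ‖iteratedFDeriv ℝ k u x‖ ^ 2) hD (C := B ^ 2) fun x hx => ?_).trans (by gcongr)
    rw [Real.norm_of_nonneg (by positivity)]
    exact pow_le_pow_left₀ (norm_nonneg _) (hu x hx) 2
  calc sNorm k D u ≤ Real.sqrt (B ^ 2 * W) := Real.sqrt_le_sqrt h1
    _ = B * Real.sqrt W := by rw [Real.sqrt_mul (by positivity), Real.sqrt_sq hB]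

/-- **Inf-sup condition for the auxiliary mixed problem (proof of Prop. 5.5).**
Let `Q = ℙ₂(P)` with the norm `‖q‖_Q = h_P² ‖q‖_{0,P}`.  Then for every `q ∈ Q`,
`sup_{v ∈ H²₀(P)} (∫_P q v)/|v|_{2,P} ≳ h_P² ‖q‖_{0,P}`,
with hidden constant independent of `P` (a valid test function being `v = b_T² q` for
a quartic bubble `b_T` on one of the shape-regular tetrahedra contained in `P`). -/
theorem mixed_problem_infsup
    (ρ : ℝ) (hρ : 0 < ρ) :
    ∃ C > 0, ∀ (P : Set E3) (F Ed : Finset (Set E3)) (V : Finset E3) (hvp : E3 → ℝ),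
      IsPolyhedron P →
      ElemRegular ρ P F Ed V hvp →
      ∀ q : E3 → ℝ, IsPolyOn 2 univ q →
        ∃ v : E3 → ℝ, MemH20 P v ∧ 0 < sNorm 2 P v ∧
          C * diam P ^ 2 * sNorm 0 P q * sNorm 2 P v ≤ ∫ x in P, q x * v x := by
  set η : ContDiffBump (0 : E3) := ⟨ρ / 4, ρ / 2, by positivity, by linarith⟩
  obtain ⟨m, hm, K, hK, hest⟩ := exists_quadratic_estimates η
  set ω : ℝ := volume.real (closedBall (0 : E3) 1) with hω
  have hω0 : 0 < ω := ENNReal.toReal_pos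
    (measure_closedBall_pos volume (0 : E3) one_pos).ne' measure_closedBall_lt_top.ne
  refine ⟨m / (K ^ 2 * ω), by positivity, fun P _ _ _ _ hpoly hreg q hq => ?_⟩
  obtain ⟨hPo, hPb, -, -⟩ := hpoly
  obtain ⟨z, r, hr, hr0, hball, -⟩ := hreg.1
  obtain ⟨p₀, hp₀, hqp₀⟩ := hq
  have hz : z ∈ P := hball (mem_ball_self hr0)
  set h := diam P with hh_def
  have hh : 0 < h := by
    obtain ⟨w, hw⟩ := exists_norm_eq E3 (half_pos hr0).le
    refine diam_pos ⟨z + w, hball ?_, z, hz, ?_⟩ hPb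
    · simpa [hw] using hr0
    · intro hzw
      have : w = 0 := by simpa using hzw
      simp [this] at hw
      linarith
  obtain ⟨p, hp, hpp₀⟩ := exists_polyFn_comp_affine p₀ z h
  have hqp : ∀ x, q x = polyFn p (h⁻¹ • (x - z)) := fun x => by
    rw [hpp₀, smul_inv_smul₀ hh.ne', add_sub_cancel, hqp₀ x (mem_univ x), polyFn]
  have hPz : ∀ x ∈ P, ‖x - z‖ ≤ h := fun x hx => by
    rw [← dist_eq_norm]; exact dist_le_diam_of_mem hPb hx hz
  have hvol : volume.real P ≤ h ^ 3 * ω := by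
    have h1 : volume.real P ≤ volume.real (closedBall z h) :=
      measureReal_mono (fun x hx => by simpa [dist_eq_norm] using hPz x hx)
        measure_closedBall_lt_top.ne
    refine h1.trans_eq ?_
    rw [measureReal_def, Measure.addHaar_closedBall' volume z hh.le, ENNReal.toReal_mul,
      ENNReal.toReal_ofReal (by positivity), hω, measureReal_def]
    simp
  have htest : ∀ p', TestFun P fun x => bumpPoly η p' (h⁻¹ • (x - z)) := fun p' => by
    have hsub : tsupport (fun x => bumpPoly η p' (h⁻¹ • (x - z))) ⊆ closedBall z (ρ / 2 * h) := by
      refine closure_minimal (fun x hx => ?_) isClosed_closedBall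
      have hx' : h⁻¹ • (x - z) ∈ Function.support η := fun h0 => hx (by simp [bumpPoly, h0])
      rw [η.support_eq, mem_ball_zero_iff, norm_smul, norm_inv, Real.norm_of_nonneg hh.le,
        inv_mul_lt_iff₀ hh] at hx'
      rw [mem_closedBall, dist_eq_norm]
      exact hx'.le.trans_eq (mul_comm _ _)
    refine ⟨(contDiff_bumpPoly η p').comp (by fun_prop),
      (isCompact_closedBall z _).of_isClosed_subset (isClosed_tsupport _) hsub, ?_⟩
    rw [hPo.interior_eq]
    refine hsub.trans ((closedBall_subset_ball ?_).trans hball)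
    nlinarith [mul_pos hρ hh]
  rcases eq_or_ne p 0 with rfl | hp0
  · refine ⟨_, (htest 1).memH20, (htest 1).sNorm_two_pos (x₀ := z) ?_, ?_⟩
    · simp [bumpPoly, polyFn, η.one_of_mem_closedBall (mem_closedBall_self η.rIn_pos.le)]
    · have : q = fun _ => 0 := funext fun x => by simp [hqp, polyFn]
      simp [this, sNorm]
  obtain ⟨N, hN, hb0, hb2, hA⟩ := hest p (hp.trans hp₀)
  set v : E3 → ℝ := fun x => bumpPoly η p (h⁻¹ • (x - z)) with hv
  obtain ⟨y, hy⟩ : ∃ y, bumpPoly η p y ≠ 0 := by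
    by_contra! h0
    simpa [h0] using integral_bumpPoly_mul_self_pos η hp0
  refine ⟨v, (htest p).memH20, (htest p).sNorm_two_pos (x₀ := z + h • y)
    (by simpa [smul_smul, hh.ne'] using hy), ?_⟩
  have hInt : ∫ x in P, q x * v x = h ^ 3 * ∫ y, bumpPoly η p y * polyFn p y := by
    rw [setIntegral_eq_integral_of_forall_compl_eq_zero fun x hx => ?_]
    · have h1 : ∀ x, q x * v x = (fun y => bumpPoly η p (h⁻¹ • y) * polyFn p (h⁻¹ • y)) (x - z) :=
        fun x => by simp only [hqp, hv]; ring
      simp_rw [h1]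
      rw [integral_sub_right_eq_self (μ := volume)
        (fun y => bumpPoly η p (h⁻¹ • y) * polyFn p (h⁻¹ • y)) z,
        Measure.integral_comp_inv_smul_of_nonneg volume
          (fun y => bumpPoly η p y * polyFn p y) hh.le]
      simp
    · have : v x = 0 := image_eq_zero_of_notMem_tsupport
        fun hx' => hx (interior_subset ((htest p).2.2 hx'))
      simp [this]
  have hPfin : volume P < ⊤ := hPb.measure_lt_top
  have hs0 : sNorm 0 P q ≤ K * N * Real.sqrt (h ^ 3 * ω) :=
    sNorm_le_of_bound (by positivity) hPfin hvol fun x hx => by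
      rw [norm_iteratedFDeriv_zero, hqp, Real.norm_eq_abs]
      refine hb0 _ ?_
      rw [mem_closedBall_zero_iff, norm_smul, norm_inv, Real.norm_of_nonneg hh.le,
        inv_mul_le_iff₀ hh, mul_one]
      exact hPz x hx
  have hs2 : sNorm 2 P v ≤ K * N * h⁻¹ ^ 2 * Real.sqrt (h ^ 3 * ω) :=
    sNorm_le_of_bound (by positivity) hPfin hvol fun x _ =>
      (norm_iteratedFDeriv_two_comp_affine_le (contDiff_bumpPoly η p (n := 2)) z hh x).trans
        (by gcongr; exact hb2 _)
  calc m / (K ^ 2 * ω) * h ^ 2 * sNorm 0 P q * sNorm 2 P v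
      ≤ m / (K ^ 2 * ω) * h ^ 2 * (K * N * Real.sqrt (h ^ 3 * ω)) *
          (K * N * h⁻¹ ^ 2 * Real.sqrt (h ^ 3 * ω)) := by
        gcongr
        exact Real.sqrt_nonneg _
    _ = m / (K ^ 2 * ω) * h ^ 2 * (K * N) * (K * N * h⁻¹ ^ 2) *
          (Real.sqrt (h ^ 3 * ω) * Real.sqrt (h ^ 3 * ω)) := by ring
    _ = h ^ 3 * (m * N ^ 2) := by
        rw [Real.mul_self_sqrt (by positivity)]
        field_simp
    _ ≤ ∫ x in P, q x * v x := by rw [hInt]; gcongr
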